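/- arXiv:2504.06449 — 3 statements merged into one kernel-verified Lean document; each statement's English description precedes it below -/
import Mathlib

section
/- Let κ ≥ 2 be an integer and α, β ∈ ℝ. Then there exists a constant C_F ∈ (0, ∞), depending only on α, β, κ, such that for all (a,b,c), (a',b',c') ∈ ℝ³ with A := M_κ(a,b,c) and B := M_κ(a',b',c') both positive definite, the entrywise sup-norm bound ‖F(A) − F(B)‖ ≤ C_F·‖A − B‖ holds, where F(A) := 2I − L(A)A − A L(A)ᵀ and ‖·‖ denotes the maximum absolute value of the matrix entries. -/
open Matrix

/-- The matrix `M_κ(a,b,c)`. -/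
def Mmat (κ : ℕ) (a b c : ℝ) : Matrix (Fin (κ + 1)) (Fin (κ + 1)) ℝ :=
  Matrix.of fun i j => if i = j then a else if i = 0 ∨ j = 0 then b else c

/-- `f(a,b,c) = b(a−c)/(a²−b²)`. -/
noncomputable def fFun (a b c : ℝ) : ℝ := b * (a - c) / (a ^ 2 - b ^ 2)

/-- `g(a,b,c) = (ac−b²)/(a²−b²)`. -/
noncomputable def gFun (a b c : ℝ) : ℝ := (a * c - b ^ 2) / (a ^ 2 - b ^ 2)

/-- `Q`: the matrix whose only nonzero entry is a `1` in position `(0,0)`. -/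
def Qmat (κ : ℕ) : Matrix (Fin (κ + 1)) (Fin (κ + 1)) ℝ :=
  Matrix.of fun i j => if i = 0 ∧ j = 0 then 1 else 0

/-- `P`: the matrix whose `(i,j)` entry is `1` iff `i = 0` and `j ≠ 0`. -/
def Pmat (κ : ℕ) : Matrix (Fin (κ + 1)) (Fin (κ + 1)) ℝ :=
  Matrix.of fun i j => if i = 0 ∧ j ≠ 0 then 1 else 0

/-- `R`: the all-ones matrix. -/
def Rmat (κ : ℕ) : Matrix (Fin (κ + 1)) (Fin (κ + 1)) ℝ :=
  Matrix.of fun _ _ => 1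

/-- `J := P + Pᵀ`. -/
def Jmat (κ : ℕ) : Matrix (Fin (κ + 1)) (Fin (κ + 1)) ℝ := Pmat κ + (Pmat κ)ᵀ

/-- `K := R − I − J`. -/
def Kmat (κ : ℕ) : Matrix (Fin (κ + 1)) (Fin (κ + 1)) ℝ := Rmat κ - 1 - Jmat κ

/-- `α̃(M_κ(a,b,c)) = α + (β(κ−1)/κ)·f(a,b,c)`. -/
noncomputable def alphaTilde (κ : ℕ) (α β a b c : ℝ) : ℝ :=
  α + (β * ((κ : ℝ) - 1) / (κ : ℝ)) * fFun a b c

/-- `β̃(M_κ(a,b,c)) = β/κ + (β(κ−1)/κ)·g(a,b,c)`. -/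
noncomputable def betaTilde (κ : ℕ) (α β a b c : ℝ) : ℝ :=
  β / (κ : ℝ) + (β * ((κ : ℝ) - 1) / (κ : ℝ)) * gFun a b c

/-- `L(M_κ(a,b,c)) = α·Q + α̃·(I − Q) + (β/κ)·P + β̃·Pᵀ`. -/
noncomputable def Lmat (κ : ℕ) (α β a b c : ℝ) : Matrix (Fin (κ + 1)) (Fin (κ + 1)) ℝ :=
  α • Qmat κ + alphaTilde κ α β a b c • (1 - Qmat κ) + (β / (κ : ℝ)) • Pmat κ +
    betaTilde κ α β a b c • (Pmat κ)ᵀ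

/-- `F(M_κ(a,b,c)) := 2I − L(A)A − AL(A)ᵀ` with `A = M_κ(a,b,c)`. -/
noncomputable def Fmat (κ : ℕ) (α β a b c : ℝ) : Matrix (Fin (κ + 1)) (Fin (κ + 1)) ℝ :=
  (2 : ℝ) • (1 : Matrix (Fin (κ + 1)) (Fin (κ + 1)) ℝ)
    - Lmat κ α β a b c * Mmat κ a b c - Mmat κ a b c * (Lmat κ α β a b c)ᵀ

/-- The entrywise sup-norm (`ℓ∞` norm) of a matrix: the maximum absolute value of its
entries. -/
noncomputable def matSupNorm {n : ℕ} (A : Matrix (Fin n) (Fin n) ℝ) : ℝ :=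
  ⨆ i : Fin n, ⨆ j : Fin n, |A i j|

/-- The scalar `h(a,b,c) = g·b + f·c`, rewritten as a difference of two quotients. -/
noncomputable def hFun (a b c : ℝ) : ℝ :=
  b - ((a - c) ^ 2 / (a - b) - (a - c) ^ 2 / (a + b)) / 2

lemma gFun_mul_add_fFun_mul {a b c : ℝ} (hm : a - b ≠ 0) (hp : a + b ≠ 0) :
    gFun a b c * a + fFun a b c * b = c ∧ gFun a b c * b + fFun a b c * a = b ∧
      gFun a b c * b + fFun a b c * c = hFun a b c := by
  have hD : a ^ 2 - b ^ 2 = (a - b) * (a + b) := by ring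
  unfold gFun fFun hFun
  rw [hD]
  refine ⟨?_, ?_, ?_⟩ <;> field_simp <;> ring

lemma Mmat_transpose (κ : ℕ) (a b c : ℝ) : (Mmat κ a b c)ᵀ = Mmat κ a b c := by
  ext i j
  simp [Mmat, eq_comm, or_comm]

lemma Mmat_zero_zero (κ : ℕ) (a b c : ℝ) : Mmat κ a b c 0 0 = a := by simp [Mmat]

lemma Mmat_zero_succ {κ : ℕ} (a b c : ℝ) (j : Fin κ) : Mmat κ a b c 0 j.succ = b := by
  simp [Mmat, (Fin.succ_ne_zero j).symm]

lemma Mmat_succ_zero {κ : ℕ} (a b c : ℝ) (i : Fin κ) : Mmat κ a b c i.succ 0 = b := by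
  simp [Mmat]

lemma Mmat_succ_succ {κ : ℕ} (a b c : ℝ) (i j : Fin κ) :
    Mmat κ a b c i.succ j.succ = c + if i = j then a - c else 0 := by
  by_cases h : i = j <;> simp [Mmat, h]

lemma Lmat_mul_Mmat {κ : ℕ} (hκ : κ ≠ 0) (α β : ℝ) {a b c : ℝ}
    (hm : a - b ≠ 0) (hp : a + b ≠ 0) :
    Lmat κ α β a b c * Mmat κ a b c =
      α • Mmat κ a b c + (β / κ) • Mmat κ b a b +
        (β * ((κ : ℝ) - 1) / κ) • Mmat κ b c (hFun a b c) := by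
  have hκ' : (κ : ℝ) ≠ 0 := by exact_mod_cast hκ
  obtain ⟨h₁, h₂, h₃⟩ := gFun_mul_add_fFun_mul (c := c) hm hp
  have e00 : Lmat κ α β a b c 0 0 = α := by simp [Lmat, Qmat, Pmat]
  have e0s (k : Fin κ) : Lmat κ α β a b c 0 k.succ = β / κ := by
    simp [Lmat, Qmat, Pmat, (Fin.succ_ne_zero k).symm]
  have es0 (i : Fin κ) : Lmat κ α β a b c i.succ 0 = betaTilde κ α β a b c := by
    simp [Lmat, Qmat, Pmat]
  have ess (i k : Fin κ) : Lmat κ α β a b c i.succ k.succ =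
      if i = k then alphaTilde κ α β a b c else 0 := by
    simp [Lmat, Qmat, Pmat, Matrix.one_apply]
  ext i j
  rw [Matrix.mul_apply, Fin.sum_univ_succ]
  simp only [Matrix.add_apply, Matrix.smul_apply, smul_eq_mul]
  refine Fin.cases ?_ (fun i => ?_) i <;> refine Fin.cases ?_ (fun j => ?_) j
  · simp only [e00, e0s, Mmat_zero_zero, Mmat_succ_zero, Finset.sum_const, Finset.card_univ,
      Fintype.card_fin, nsmul_eq_mul]
    field_simp
    ring
  · simp only [e00, e0s, Mmat_zero_succ, Mmat_succ_succ, ← Finset.mul_sum,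
      Finset.sum_add_distrib, Finset.sum_const, Finset.card_univ, Fintype.card_fin, nsmul_eq_mul,
      Finset.sum_ite_eq', Finset.mem_univ, if_true]
    field_simp
    ring
  · simp only [es0, ess, Mmat_zero_zero, Mmat_succ_zero, ite_mul, zero_mul, Finset.sum_ite_eq,
      Finset.mem_univ, if_true, alphaTilde, betaTilde]
    linear_combination (β * ((κ : ℝ) - 1) / κ) * h₁
  · simp only [es0, ess, Mmat_zero_succ, Mmat_succ_succ, ite_mul, zero_mul, Finset.sum_ite_eq,
      Finset.mem_univ, if_true, alphaTilde, betaTilde]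
    split_ifs
    · linear_combination (β * ((κ : ℝ) - 1) / κ) * h₂
    · linear_combination (β * ((κ : ℝ) - 1) / κ) * h₃

lemma Fmat_eq {κ : ℕ} (hκ : κ ≠ 0) (α β : ℝ) {a b c : ℝ}
    (hm : a - b ≠ 0) (hp : a + b ≠ 0) :
    Fmat κ α β a b c = (2 : ℝ) • (1 : Matrix (Fin (κ + 1)) (Fin (κ + 1)) ℝ) -
      (2 : ℝ) • (α • Mmat κ a b c + (β / κ) • Mmat κ b a b +
        (β * ((κ : ℝ) - 1) / κ) • Mmat κ b c (hFun a b c)) := by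
  have ht : Mmat κ a b c * (Lmat κ α β a b c)ᵀ = (Lmat κ α β a b c * Mmat κ a b c)ᵀ := by
    rw [Matrix.transpose_mul, Mmat_transpose]
  rw [Fmat, ht, Lmat_mul_Mmat hκ α β hm hp]
  simp only [Matrix.transpose_add, Matrix.transpose_smul, Mmat_transpose]
  module

lemma abs_apply_le_matSupNorm {n : ℕ} (A : Matrix (Fin n) (Fin n) ℝ) (i j : Fin n) :
    |A i j| ≤ matSupNorm A :=
  (le_ciSup (f := fun j => |A i j|) (Set.finite_range _).bddAbove j).trans
    (le_ciSup (f := fun i => ⨆ j, |A i j|) (Set.finite_range _).bddAbove i)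

lemma matSupNorm_le {n : ℕ} {A : Matrix (Fin (n + 1)) (Fin (n + 1)) ℝ} {x : ℝ}
    (h : ∀ i j, |A i j| ≤ x) : matSupNorm A ≤ x :=
  ciSup_le fun i => ciSup_le fun j => h i j

lemma abs_Mmat_sub_apply_le (κ : ℕ) {a b c a' b' c' x : ℝ} (ha : |a - a'| ≤ x)
    (hb : |b - b'| ≤ x) (hc : |c - c'| ≤ x) (i j : Fin (κ + 1)) :
    |Mmat κ a b c i j - Mmat κ a' b' c' i j| ≤ x := by
  simp only [Mmat, Matrix.of_apply]
  split_ifs <;> assumption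

lemma abs_sub_le_matSupNorm_Mmat_sub {κ : ℕ} (hκ : 2 ≤ κ) (a b c a' b' c' : ℝ) :
    |a - a'| ≤ matSupNorm (Mmat κ a b c - Mmat κ a' b' c') ∧
      |b - b'| ≤ matSupNorm (Mmat κ a b c - Mmat κ a' b' c') ∧
      |c - c'| ≤ matSupNorm (Mmat κ a b c - Mmat κ a' b' c') := by
  let i₀ : Fin κ := ⟨0, by omega⟩
  let i₁ : Fin κ := ⟨1, by omega⟩
  have hne : i₀ ≠ i₁ := by simp [i₀, i₁]
  have h := abs_apply_le_matSupNorm (Mmat κ a b c - Mmat κ a' b' c')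
  refine ⟨?_, ?_, ?_⟩
  · simpa [Mmat_zero_zero] using h 0 0
  · simpa [Mmat_zero_succ] using h 0 i₀.succ
  · simpa [Mmat_succ_succ, hne] using h i₀.succ i₁.succ

lemma Mmat_posDef_bounds {κ : ℕ} (hκ : 2 ≤ κ) {a b c : ℝ} (h : (Mmat κ a b c).PosDef) :
    0 < a - b ∧ 0 < a + b ∧ 0 ≤ a - c ∧ a - c ≤ 4 * (a - b) ∧ a - c ≤ 4 * (a + b) := by
  have h3 := h.submatrix (Fin.castLE_injective (by omega : 3 ≤ κ + 1))
  have hsub : (Mmat κ a b c).submatrix (Fin.castLE (by omega : 3 ≤ κ + 1))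
      (Fin.castLE (by omega : 3 ≤ κ + 1)) = !![a, b, b; b, a, c; b, c, a] := by
    ext i j
    have hz (k : Fin 3) : Fin.castLE (by omega : 3 ≤ κ + 1) k = 0 ↔ k = 0 := by
      rw [Fin.ext_iff, Fin.ext_iff]
      rfl
    simp only [Matrix.submatrix_apply, Mmat, Matrix.of_apply, hz,
      (Fin.castLE_injective (by omega : 3 ≤ κ + 1)).eq_iff]
    fin_cases i <;> fin_cases j <;> simp
  rw [hsub] at h3
  have key (x y z : ℝ) (hne : x ≠ 0 ∨ y ≠ 0) :
      0 < x * (a * x + b * y + b * z) + y * (b * x + a * y + c * z) +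
        z * (b * x + c * y + a * z) := by
    have := h3.dotProduct_mulVec_pos (x := ![x, y, z]) (by
      rintro h0
      have h0x := congrFun h0 0
      have h0y := congrFun h0 1
      simp at h0x h0y
      tauto)
    simpa [Matrix.mulVec, dotProduct, Fin.sum_univ_three] using this
  have k₁ := key 1 (-1) 0 (by norm_num)
  have k₂ := key 1 1 0 (by norm_num)
  have k₃ := key 0 1 (-1) (by norm_num)
  have k₄ := key (-2) 1 1 (by norm_num)
  have k₅ := key 2 1 1 (by norm_num)
  refine ⟨?_, ?_, ?_, ?_, ?_⟩ <;> linarith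

/-- `(d, y) ↦ d² / y` is Lipschitz on the cone `0 ≤ d ≤ M y`, `0 < y`. -/
lemma abs_sq_div_sub_sq_div_le {M d y d' y' : ℝ} (hy : 0 < y) (hy' : 0 < y') (hd : 0 ≤ d)
    (hd' : 0 ≤ d') (hM : d ≤ M * y) (hM' : d' ≤ M * y') :
    |d ^ 2 / y - d' ^ 2 / y'| ≤ 2 * M * |d - d'| + M ^ 2 * |y - y'| := by
  have hp : d / y ≤ M := (div_le_iff₀ hy).2 hM
  have hp' : d' / y' ≤ M := (div_le_iff₀ hy').2 hM'
  have hp0 : 0 ≤ d / y := by positivity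
  have hp0' : 0 ≤ d' / y' := by positivity
  have e : d ^ 2 / y - d' ^ 2 / y' =
      (d / y + d' / y') * (d - d') - (d / y) * (d' / y') * (y - y') := by
    field_simp
    ring
  rw [e]
  refine (abs_sub _ _).trans ?_
  rw [abs_mul, abs_mul, abs_of_nonneg (add_nonneg hp0 hp0'), abs_of_nonneg (mul_nonneg hp0 hp0')]
  have h₁ : d / y + d' / y' ≤ 2 * M := by linarith
  have h₂ : d / y * (d' / y') ≤ M ^ 2 := by
    rw [sq]
    exact mul_le_mul hp hp' hp0' (hp0.trans hp)
  gcongr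

lemma abs_hFun_sub_hFun_le {κ : ℕ} (hκ : 2 ≤ κ) {a b c a' b' c' x : ℝ}
    (h : (Mmat κ a b c).PosDef) (h' : (Mmat κ a' b' c').PosDef)
    (ha : |a - a'| ≤ x) (hb : |b - b'| ≤ x) (hc : |c - c'| ≤ x) :
    |hFun a b c - hFun a' b' c'| ≤ 49 * x := by
  obtain ⟨hm, hp, hd, hdm, hdp⟩ := Mmat_posDef_bounds hκ h
  obtain ⟨hm', hp', hd', hdm', hdp'⟩ := Mmat_posDef_bounds hκ h'
  have k₁ := abs_sq_div_sub_sq_div_le hm hm' hd hd' hdm hdm'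
  have k₂ := abs_sq_div_sub_sq_div_le hp hp' hd hd' hdp hdp'
  have d₁ : |(a - c) - (a' - c')| ≤ 2 * x := by rw [abs_le] at *; constructor <;> linarith
  have d₂ : |(a - b) - (a' - b')| ≤ 2 * x := by rw [abs_le] at *; constructor <;> linarith
  have d₃ : |(a + b) - (a' + b')| ≤ 2 * x := by rw [abs_le] at *; constructor <;> linarith
  have l₁ := abs_le.1 (k₁.trans (b := _) (c := 48 * x) (by linarith))
  have l₂ := abs_le.1 (k₂.trans (b := _) (c := 48 * x) (by linarith))
  rw [abs_le] at hb ⊢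
  unfold hFun
  constructor <;> linarith

/-- `F` is uniformly Lipschitz, in the entrywise sup-norm, on the set of
positive definite matrices of the form `M_κ(a,b,c)`, with a Lipschitz constant depending
only on `α`, `β`, `κ`. -/
theorem stmt8 (κ : ℕ) (hκ : 2 ≤ κ) (α β : ℝ) :
    ∃ C : ℝ, 0 < C ∧ ∀ a b c a' b' c' : ℝ,
      (Mmat κ a b c).PosDef → (Mmat κ a' b' c').PosDef →
      matSupNorm (Fmat κ α β a b c - Fmat κ α β a' b' c')
        ≤ C * matSupNorm (Mmat κ a b c - Mmat κ a' b' c') := by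
  set q := β / κ with hq
  set s := β * ((κ : ℝ) - 1) / κ with hs
  refine ⟨2 * (|α| + |q| + 49 * |s|) + 1, by positivity, fun a b c a' b' c' h h' => ?_⟩
  obtain ⟨ha, hb, hc⟩ := abs_sub_le_matSupNorm_Mmat_sub hκ a b c a' b' c'
  set x := matSupNorm (Mmat κ a b c - Mmat κ a' b' c')
  have hx : 0 ≤ x := (abs_nonneg _).trans ha
  have hh := abs_hFun_sub_hFun_le hκ h h' ha hb hc
  obtain ⟨hm, hp, -⟩ := Mmat_posDef_bounds hκ h
  obtain ⟨hm', hp', -⟩ := Mmat_posDef_bounds hκ h'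
  refine matSupNorm_le fun i j => ?_
  have m₁ := abs_Mmat_sub_apply_le κ ha hb hc i j
  have m₂ := abs_Mmat_sub_apply_le κ hb ha hb i j
  have m₃ := abs_Mmat_sub_apply_le κ (hb.trans (by linarith)) (hc.trans (by linarith)) hh i j
  rw [Fmat_eq (by omega) α β hm.ne' hp.ne', Fmat_eq (by omega) α β hm'.ne' hp'.ne', ← hq, ← hs]
  simp only [Matrix.sub_apply, Matrix.add_apply, Matrix.smul_apply, smul_eq_mul]
  set u₁ := Mmat κ a b c i j - Mmat κ a' b' c' i j with hu₁
  set u₂ := Mmat κ b a b i j - Mmat κ b' a' b' i j with hu₂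
  set u₃ := Mmat κ b c (hFun a b c) i j - Mmat κ b' c' (hFun a' b' c') i j with hu₃
  calc _ = |(-2) * (α * u₁ + q * u₂ + s * u₃)| := by
        rw [hu₁, hu₂, hu₃]
        ring_nf
    _ = 2 * |α * u₁ + q * u₂ + s * u₃| := by rw [abs_mul]; norm_num
    _ ≤ 2 * (|α| * |u₁| + |q| * |u₂| + |s| * |u₃|) := by
        rw [← abs_mul, ← abs_mul, ← abs_mul]
        gcongr
        exact abs_add_three _ _ _
    _ ≤ 2 * (|α| * x + |q| * x + |s| * (49 * x)) := by gcongr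
    _ ≤ (2 * (|α| + |q| + 49 * |s|) + 1) * x := by linarith
end

section
/- Let α, β, σ ∈ ℝ with 0 < |β| < α. For r ∈ {0, 1, 2} and t ≥ 0 define σ_r^{ρ_t} := (−sign β)^r·[ σ²·e^{−2tα}·I_r(2t|β|) + 2·∫₀ᵗ e^{−2sα}·I_r(2s|β|) ds ] and σ_r^π := (−β)^r / ( √(α² − β²)·(α + √(α² − β²))^r ). Then for all t ≥ 0 and r ∈ {0, 1, 2}, |σ_r^{ρ_t} − σ_r^π| ≤ ( σ² + 4/(α − |β|) )·e^{−2(α − |β|)t}. -/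
/-- `I_r(y) = ∫₀¹ cos(rπx)·e^{y cos(πx)} dx`, the modified Bessel function of the first
kind of order `r`. -/
noncomputable def besselI (r : ℕ) (y : ℝ) : ℝ :=
  ∫ x in (0 : ℝ)..1, Real.cos (r * Real.pi * x) * Real.exp (y * Real.cos (Real.pi * x))

/-- `σ_r^{ρ_t} = (−sign β)^r·(σ²e^{−2tα}I_r(2t|β|) + 2∫₀ᵗ e^{−2sα}I_r(2s|β|) ds)`. -/
noncomputable def sigmaRho (α β σ : ℝ) (r : ℕ) (t : ℝ) : ℝ :=
  (-Real.sign β) ^ r *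
    (σ ^ 2 * Real.exp (-2 * t * α) * besselI r (2 * t * |β|) +
      2 * ∫ s in (0 : ℝ)..t, Real.exp (-2 * s * α) * besselI r (2 * s * |β|))

/-- `σ_r^π = (−β)^r / (√(α²−β²)(α+√(α²−β²))^r)`. -/
noncomputable def sigmaPi (α β : ℝ) (r : ℕ) : ℝ :=
  (-β) ^ r / (Real.sqrt (α ^ 2 - β ^ 2) * (α + Real.sqrt (α ^ 2 - β ^ 2)) ^ r)

lemma sub_mul_cos_pos {a b : ℝ} (hb : 0 ≤ b) (hab : b < a) (θ : ℝ) :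
    0 < a - b * Real.cos θ := by
  nlinarith [Real.cos_le_one θ]

lemma hasDerivAt_arctan_sin_div {q : ℝ} (hq0 : 0 ≤ q) (hq1 : q < 1) (θ : ℝ) :
    HasDerivAt (fun θ => Real.arctan (q * Real.sin θ / (1 - q * Real.cos θ)))
      ((q * Real.cos θ - q ^ 2) / (1 - 2 * q * Real.cos θ + q ^ 2)) θ := by
  have hd : 0 < 1 - q * Real.cos θ := sub_mul_cos_pos hq0 hq1 θ
  have hN : 0 < 1 - 2 * q * Real.cos θ + q ^ 2 := by
    nlinarith [Real.sin_sq_add_cos_sq θ, sq_nonneg (q * Real.sin θ), pow_pos hd 2]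
  have h := (((Real.hasDerivAt_sin θ).const_mul q).div
    (((Real.hasDerivAt_cos θ).const_mul q).const_sub 1) hd.ne').arctan
  refine h.congr_deriv ?_
  have hd' := hd.ne'
  have hN' := hN.ne'
  have hS : Real.sin θ ^ 2 = 1 - Real.cos θ ^ 2 := Real.sin_sq θ
  have h2 : 1 + (q * Real.sin θ / (1 - q * Real.cos θ)) ^ 2
      = (1 - 2 * q * Real.cos θ + q ^ 2) / (1 - q * Real.cos θ) ^ 2 := by
    field_simp
    linear_combination q ^ 2 * hS
  simp only [Pi.div_apply]
  rw [h2]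
  field_simp
  linear_combination -q ^ 2 * hS

lemma integral_one_div_sub_mul_cos {a b : ℝ} (hb : 0 < b) (hab : b < a) :
    ∫ x in (0 : ℝ)..1, 1 / (a - b * Real.cos (Real.pi * x)) = 1 / √(a ^ 2 - b ^ 2) := by
  have hpos : 0 < a ^ 2 - b ^ 2 := by nlinarith
  have hS := Real.sqrt_pos.2 hpos
  have hS2 := Real.sq_sqrt hpos.le
  set S := √(a ^ 2 - b ^ 2)
  obtain ⟨q, hq⟩ : ∃ q, q = b / (a + S) := ⟨_, rfl⟩
  have haS : 0 < a + S := by linarith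
  have hq0 : 0 < q := hq ▸ div_pos hb haS
  have hq1 : q < 1 := by rw [hq, div_lt_one haS]; linarith
  have hbq : q * (a + S) = b := by rw [hq]; field_simp
  have hqb : q * b = a - S := by
    rw [hq]; field_simp; linear_combination hS2
  have hderiv : ∀ x : ℝ, HasDerivAt (fun x => (x + 2 / Real.pi *
      Real.arctan (q * Real.sin (Real.pi * x) / (1 - q * Real.cos (Real.pi * x)))) / S)
      (1 / (a - b * Real.cos (Real.pi * x))) x := by
    intro x
    have hd := sub_mul_cos_pos hb.le hab (Real.pi * x)
    have hN : 2 * q * (a - b * Real.cos (Real.pi * x))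
        = b * (1 - 2 * q * Real.cos (Real.pi * x) + q ^ 2) := by
      linear_combination hbq - q * hqb
    have hN0 : 0 < 1 - 2 * q * Real.cos (Real.pi * x) + q ^ 2 := by
      refine pos_of_mul_pos_right (a := b) ?_ hb.le
      rw [← hN]; positivity
    have h := (((hasDerivAt_id x).add
      (((hasDerivAt_arctan_sin_div hq0.le hq1 (Real.pi * x)).comp x
        ((hasDerivAt_id x).const_mul Real.pi)).const_mul (2 / Real.pi))).div_const S)
    refine h.congr_deriv ?_
    have hπ := Real.pi_pos
    have hd' := hd.ne'
    have hN' := hN0.ne'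
    generalize Real.cos (Real.pi * x) = c at *
    have h2 : 2 * q * S = b * (1 - q ^ 2) := by
      linear_combination hbq + q * hqb
    have h3 : S * (1 - 2 * q * c + q ^ 2) = (a - b * c) * (1 - q ^ 2) := by
      have : b * (S * (1 - 2 * q * c + q ^ 2)) = b * ((a - b * c) * (1 - q ^ 2)) := by
        linear_combination (a - b * c) * h2 - S * hN
      exact mul_left_cancel₀ hb.ne' this
    have h4 : 1 + 2 / Real.pi * ((q * c - q ^ 2) / (1 - 2 * q * c + q ^ 2) * (Real.pi * 1))
        = (1 - q ^ 2) / (1 - 2 * q * c + q ^ 2) := by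
      field_simp
      ring
    rw [h4, div_div, div_eq_div_iff (mul_ne_zero hN' hS.ne') hd']
    linear_combination -h3
  rw [intervalIntegral.integral_eq_sub_of_hasDerivAt (fun x _ => hderiv x)]
  · simp
  · refine Continuous.intervalIntegrable ?_ _ _
    exact continuous_const.div (by fun_prop) fun x => (sub_mul_cos_pos hb.le hab _).ne'

lemma continuous_cos_div_sub_mul_cos {a b : ℝ} (hb : 0 ≤ b) (hab : b < a) (r : ℕ) :
    Continuous fun x : ℝ => Real.cos (r * Real.pi * x) / (a - b * Real.cos (Real.pi * x)) :=
  Continuous.div (by fun_prop) (by fun_prop) fun _ => (sub_mul_cos_pos hb hab _).ne'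

lemma integral_cos_nat_mul_pi {n : ℕ} (hn : n ≠ 0) :
    ∫ x in (0 : ℝ)..1, Real.cos (n * Real.pi * x) = 0 := by
  have hn' : (n : ℝ) * Real.pi ≠ 0 := by positivity
  rw [intervalIntegral.integral_comp_mul_left (fun x => Real.cos x) hn']
  simp

lemma integral_cos_div_sub_mul_cos {a b : ℝ} (hb : 0 < b) (hab : b < a) (r : ℕ) :
    ∫ x in (0 : ℝ)..1, Real.cos (r * Real.pi * x) / (a - b * Real.cos (Real.pi * x))
      = b ^ r / (√(a ^ 2 - b ^ 2) * (a + √(a ^ 2 - b ^ 2)) ^ r) := by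
  have h0 := integral_one_div_sub_mul_cos hb hab
  have hpos : 0 < a ^ 2 - b ^ 2 := by nlinarith
  have hS := Real.sqrt_pos.2 hpos
  have hS2 := Real.sq_sqrt hpos.le
  set S := √(a ^ 2 - b ^ 2)
  have haS : 0 < a + S := by linarith
  have hd := fun x : ℝ => sub_mul_cos_pos hb.le hab (Real.pi * x)
  have hint := fun n : ℕ =>
    (continuous_cos_div_sub_mul_cos hb.le hab n).intervalIntegrable
      (μ := MeasureTheory.volume) 0 1
  induction r using Nat.twoStepInduction with
  | zero => simpa using h0
  | one =>
    have h : ∀ x : ℝ, Real.cos ((1 : ℕ) * Real.pi * x) / (a - b * Real.cos (Real.pi * x))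
        = a / b * (1 / (a - b * Real.cos (Real.pi * x))) - 1 / b := by
      intro x
      have := (hd x).ne'
      set c := Real.cos (Real.pi * x)
      rw [Nat.cast_one, one_mul]
      field_simp
      ring
    have hi : IntervalIntegrable (fun x : ℝ => 1 / (a - b * Real.cos (Real.pi * x)))
        MeasureTheory.volume 0 1 := by simpa using hint 0
    simp_rw [h]
    rw [intervalIntegral.integral_sub (hi.const_mul _) (by simp),
      intervalIntegral.integral_const_mul, h0]
    simp only [intervalIntegral.integral_const, smul_eq_mul, pow_one]
    field_simp
    linear_combination -hS2
  | more n ih0 ih1 =>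
    have h : ∀ x : ℝ,
        Real.cos ((n + 2 : ℕ) * Real.pi * x) / (a - b * Real.cos (Real.pi * x))
        = 2 * a / b *
            (Real.cos ((n + 1 : ℕ) * Real.pi * x) / (a - b * Real.cos (Real.pi * x)))
          - Real.cos (n * Real.pi * x) / (a - b * Real.cos (Real.pi * x))
          - 2 / b * Real.cos ((n + 1 : ℕ) * Real.pi * x) := by
      intro x
      have := (hd x).ne'
      set c := Real.cos (Real.pi * x)
      have e2 : ((n + 2 : ℕ) : ℝ) * Real.pi * x
          = (n + 1 : ℕ) * Real.pi * x + Real.pi * x := by push_cast; ring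
      have e0 : (n : ℝ) * Real.pi * x
          = (n + 1 : ℕ) * Real.pi * x - Real.pi * x := by push_cast; ring
      rw [e2, e0, Real.cos_add, Real.cos_sub]
      field_simp
      ring
    have hi : IntervalIntegrable (fun x : ℝ => Real.cos ((n + 1 : ℕ) * Real.pi * x))
        MeasureTheory.volume 0 1 := Continuous.intervalIntegrable (by fun_prop) _ _
    simp_rw [h]
    rw [intervalIntegral.integral_sub (((hint (n + 1)).const_mul _).sub (hint n))
        (hi.const_mul _),
      intervalIntegral.integral_sub ((hint (n + 1)).const_mul _) (hint n),
      intervalIntegral.integral_const_mul, intervalIntegral.integral_const_mul,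
      ih0, ih1, integral_cos_nat_mul_pi n.succ_ne_zero]
    rw [pow_add, pow_add, pow_add, pow_add, pow_one, pow_one]
    field_simp
    linear_combination -b * b ^ n * hS2

lemma abs_besselI_le (r : ℕ) {y : ℝ} (hy : 0 ≤ y) : |besselI r y| ≤ Real.exp y := by
  have h := intervalIntegral.norm_integral_le_of_norm_le_const (a := 0) (b := 1)
    (C := Real.exp y)
    (f := fun x => Real.cos (r * Real.pi * x) * Real.exp (y * Real.cos (Real.pi * x))) ?_
  · simpa [besselI] using h
  · intro x _
    rw [norm_mul, Real.norm_eq_abs, Real.norm_eq_abs, Real.abs_exp]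
    have h1 : Real.exp (y * Real.cos (Real.pi * x)) ≤ Real.exp y :=
      Real.exp_le_exp.2 (mul_le_of_le_one_right hy (Real.cos_le_one _))
    exact (mul_le_of_le_one_left (Real.exp_pos _).le (Real.abs_cos_le_one _)).trans h1

lemma two_mul_integral_exp_neg_mul {d : ℝ} (hd : d ≠ 0) (t : ℝ) :
    2 * ∫ s in (0 : ℝ)..t, Real.exp (-2 * d * s) = (1 - Real.exp (-2 * d * t)) / d := by
  rw [intervalIntegral.integral_comp_mul_left (fun x => Real.exp x) (by simpa using hd),
    integral_exp, smul_eq_mul, mul_zero, Real.exp_zero]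
  field_simp
  ring

lemma two_mul_integral_exp_mul_besselI {a b : ℝ} (hb : 0 ≤ b) (hab : b < a) (r : ℕ) (t : ℝ) :
    2 * ∫ s in (0 : ℝ)..t, Real.exp (-2 * s * a) * besselI r (2 * s * b)
      = ∫ x in (0 : ℝ)..1, Real.cos (r * Real.pi * x) *
          ((1 - Real.exp (-2 * (a - b * Real.cos (Real.pi * x)) * t)) /
            (a - b * Real.cos (Real.pi * x))) := by
  have h1 : ∀ s : ℝ, Real.exp (-2 * s * a) * besselI r (2 * s * b)
      = ∫ x in (0 : ℝ)..1, Real.cos (r * Real.pi * x) *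
          Real.exp (-2 * (a - b * Real.cos (Real.pi * x)) * s) := by
    intro s
    rw [besselI, ← intervalIntegral.integral_const_mul]
    congr 1 with x
    rw [mul_left_comm, ← Real.exp_add]
    ring_nf
  simp_rw [h1]
  rw [MeasureTheory.intervalIntegral_intervalIntegral_swap, ← intervalIntegral.integral_const_mul]
  · congr 1 with x
    rw [← two_mul_integral_exp_neg_mul (sub_mul_cos_pos hb hab _).ne',
      intervalIntegral.integral_const_mul]
    ring
  · refine (Continuous.integrableOn_Icc (μ := MeasureTheory.volume)
      (a := (min 0 t, min 0 1)) (b := (max 0 t, max 0 1)) ?_).mono_set ?_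
    · fun_prop
    · rw [← Set.Icc_prod_Icc]
      exact Set.prod_mono Set.Ioc_subset_Icc_self Set.Ioc_subset_Icc_self

lemma abs_two_mul_integral_sub_le {a b : ℝ} (hb : 0 < b) (hab : b < a) (r : ℕ) {t : ℝ}
    (ht : 0 ≤ t) :
    |2 * (∫ s in (0 : ℝ)..t, Real.exp (-2 * s * a) * besselI r (2 * s * b))
      - b ^ r / (√(a ^ 2 - b ^ 2) * (a + √(a ^ 2 - b ^ 2)) ^ r)|
      ≤ Real.exp (-2 * (a - b) * t) / (a - b) := by
  have hd := fun x : ℝ => sub_mul_cos_pos hb.le hab (Real.pi * x)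
  have hab' : 0 < a - b := sub_pos.2 hab
  rw [two_mul_integral_exp_mul_besselI hb.le hab, ← integral_cos_div_sub_mul_cos hb hab r,
    ← intervalIntegral.integral_sub]
  · have h := intervalIntegral.norm_integral_le_of_norm_le_const (a := 0) (b := 1)
      (C := Real.exp (-2 * (a - b) * t) / (a - b))
      (f := fun x => Real.cos (r * Real.pi * x) *
          ((1 - Real.exp (-2 * (a - b * Real.cos (Real.pi * x)) * t)) /
            (a - b * Real.cos (Real.pi * x)))
          - Real.cos (r * Real.pi * x) / (a - b * Real.cos (Real.pi * x))) ?_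
    · simpa using h
    · intro x _
      have hx := hd x
      have hle : a - b ≤ a - b * Real.cos (Real.pi * x) := by
        nlinarith [Real.cos_le_one (Real.pi * x)]
      have e : Real.cos (r * Real.pi * x) *
          ((1 - Real.exp (-2 * (a - b * Real.cos (Real.pi * x)) * t)) /
            (a - b * Real.cos (Real.pi * x)))
          - Real.cos (r * Real.pi * x) / (a - b * Real.cos (Real.pi * x))
          = -(Real.cos (r * Real.pi * x) *
            (Real.exp (-2 * (a - b * Real.cos (Real.pi * x)) * t) /
            (a - b * Real.cos (Real.pi * x)))) := by ring
      have hp : 0 < Real.exp (-2 * (a - b * Real.cos (Real.pi * x)) * t) /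
          (a - b * Real.cos (Real.pi * x)) := div_pos (Real.exp_pos _) hx
      rw [e, norm_neg, norm_mul, Real.norm_eq_abs, Real.norm_eq_abs, abs_of_pos hp]
      refine (mul_le_of_le_one_left hp.le (Real.abs_cos_le_one _)).trans ?_
      refine div_le_div₀ (Real.exp_pos _).le (Real.exp_le_exp.2 ?_) hab' hle
      nlinarith
  · refine Continuous.intervalIntegrable ?_ _ _
    exact Continuous.mul (by fun_prop)
      (Continuous.div (by fun_prop) (by fun_prop) fun x => (hd x).ne')
  · exact (continuous_cos_div_sub_mul_cos hb.le hab r).intervalIntegrable _ _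

/-- For `0 < |β| < α`, `r ∈ {0,1,2}` and `t ≥ 0`,
`|σ_r^{ρ_t} − σ_r^π| ≤ (σ² + 4/(α−|β|))·e^{−2(α−|β|)t}`. -/
theorem stmt14 (α β σ : ℝ) (hβ : 0 < |β|) (hαβ : |β| < α) (r : ℕ) (hr : r ≤ 2)
    (t : ℝ) (ht : 0 ≤ t) :
    |sigmaRho α β σ r t - sigmaPi α β r|
      ≤ (σ ^ 2 + 4 / (α - |β|)) * Real.exp (-2 * (α - |β|) * t) := by
  have hβ0 : β ≠ 0 := abs_pos.1 hβ
  have hsign : |(-Real.sign β) ^ r| = 1 := by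
    rcases Real.sign_apply_eq_of_ne_zero β hβ0 with h | h <;> simp [h]
  have hpi : sigmaPi α β r = (-Real.sign β) ^ r *
      (|β| ^ r / (√(α ^ 2 - |β| ^ 2) * (α + √(α ^ 2 - |β| ^ 2)) ^ r)) := by
    have h : -β = -Real.sign β * |β| := by
      rcases hβ0.lt_or_gt with h | h
      · rw [Real.sign_of_neg h, abs_of_neg h]; ring
      · rw [Real.sign_of_pos h, abs_of_pos h]; ring
    rw [sigmaPi, sq_abs, ← mul_div_assoc, ← mul_pow, ← h]
  have hmain := abs_two_mul_integral_sub_le hβ hαβ r ht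
  have hI : |σ ^ 2 * Real.exp (-2 * t * α) * besselI r (2 * t * |β|)|
      ≤ σ ^ 2 * Real.exp (-2 * (α - |β|) * t) := by
    have e : Real.exp (-2 * (α - |β|) * t)
        = Real.exp (-2 * t * α) * Real.exp (2 * t * |β|) := by
      rw [← Real.exp_add]; ring_nf
    rw [abs_mul, abs_of_nonneg (by positivity), e, ← mul_assoc]
    exact mul_le_mul_of_nonneg_left (abs_besselI_le r (by positivity)) (by positivity)
  have hab : 0 < α - |β| := sub_pos.2 hαβ
  rw [hpi, sigmaRho, ← mul_sub, abs_mul, hsign, one_mul, add_sub_assoc]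
  refine (abs_add_le _ _).trans ((add_le_add hI hmain).trans ?_)
  have : 0 ≤ Real.exp (-2 * (α - |β|) * t) / (α - |β|) := by positivity
  rw [add_mul, div_mul_eq_mul_div, mul_div_assoc]
  linarith
end

section
/- Let α, β ∈ ℝ with α > |β| and let r be a nonnegative integer. Then ∫₀¹ cos(2πrx)/(α + β·cos(2πx)) dx = (−β)^r / ( √(α² − β²)·(α + √(α² − β²))^r ). In particular, the limit as n → ∞ of the Riemann sums (1/n)·Σ_{l=0}^{n−1} cos(2πrl/n)/(α + β·cos(2πl/n)) equals this value, so the stationary covariances of the n-cycle Ornstein–Uhlenbeck system converge to σ_r^π := (−β)^r/(√(α²−β²)(α+√(α²−β²))^r) as n → ∞. -/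
open Filter

/-- Left Riemann sums over the uniform partitions of `[0, 1]` converge to the integral. -/
theorem tendsto_riemann_sum_integral {f : ℝ → ℝ} (hf : Continuous f) :
    Tendsto (fun n : ℕ => (1 / (n : ℝ)) * ∑ l ∈ Finset.range n, f (l / n)) atTop
      (nhds (∫ x in (0 : ℝ)..1, f x)) := by
  rw [Metric.tendsto_atTop]
  intro ε hε
  have huc : UniformContinuousOn f (Set.Icc 0 1) :=
    isCompact_Icc.uniformContinuousOn_of_continuous hf.continuousOn
  obtain ⟨δ, hδ, hfδ⟩ := Metric.uniformContinuousOn_iff.mp huc (ε / 2) (half_pos hε)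
  obtain ⟨N, hN⟩ := exists_nat_gt (1 / δ)
  refine ⟨N, fun n hn => ?_⟩
  have hNn : 1 / δ < (n : ℝ) := hN.trans_le (by exact_mod_cast hn)
  have hn0 : (0 : ℝ) < n := (one_div_pos.mpr hδ).trans hNn
  have hmesh : 1 / (n : ℝ) < δ := (one_div_lt hδ hn0).mp hNn
  have hstep (l : ℕ) : ((l + 1 : ℕ) : ℝ) / n - l / n = 1 / n := by push_cast; ring
  have hsplit : ∑ l ∈ Finset.range n, ∫ x in ((l : ℝ) / n)..(((l + 1 : ℕ) : ℝ) / n), f x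
      = ∫ x in (0 : ℝ)..1, f x := by
    rw [intervalIntegral.sum_integral_adjacent_intervals (a := fun l : ℕ => (l : ℝ) / n)
      fun _ _ => hf.intervalIntegrable _ _]
    simp [hn0.ne']
  have hlocal : ∀ l ∈ Finset.range n,
      ‖1 / (n : ℝ) * f (l / n) - ∫ x in ((l : ℝ) / n)..(((l + 1 : ℕ) : ℝ) / n), f x‖
        ≤ ε / 2 * (1 / n) := by
    intro l hl
    have hln : ((l + 1 : ℕ) : ℝ) / n ≤ 1 := by
      rw [div_le_one hn0]
      exact_mod_cast Finset.mem_range.mp hl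
    have hl0 : (0 : ℝ) ≤ l / n := by positivity
    have hle : (l : ℝ) / n ≤ ((l + 1 : ℕ) : ℝ) / n := by
      linarith [hstep l, one_div_pos.mpr hn0]
    have hdiff : 1 / (n : ℝ) * f (l / n) - ∫ x in ((l : ℝ) / n)..(((l + 1 : ℕ) : ℝ) / n), f x
        = ∫ x in ((l : ℝ) / n)..(((l + 1 : ℕ) : ℝ) / n), (f (l / n) - f x) := by
      rw [intervalIntegral.integral_sub intervalIntegrable_const (hf.intervalIntegrable _ _),
        intervalIntegral.integral_const, hstep, smul_eq_mul]
    rw [hdiff]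
    have hbound := intervalIntegral.norm_integral_le_of_norm_le_const (C := ε / 2)
      (a := (l : ℝ) / n) (b := ((l + 1 : ℕ) : ℝ) / n) (f := fun x => f (l / n) - f x) ?_
    · rwa [hstep, abs_of_pos (one_div_pos.mpr hn0)] at hbound
    · intro x hx
      rw [Set.uIoc_of_le hle] at hx
      refine (hfδ _ ⟨hl0, hle.trans hln⟩ x ⟨hl0.trans hx.1.le, hx.2.trans hln⟩ ?_).le
      rw [Real.dist_eq, abs_lt]
      constructor <;> linarith [hstep l, hx.1, hx.2]
  rw [dist_eq_norm, ← hsplit, Finset.mul_sum, ← Finset.sum_sub_distrib]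
  calc _ ≤ ∑ _l ∈ Finset.range n, ε / 2 * (1 / (n : ℝ)) := norm_sum_le_of_le _ hlocal
    _ = ε / 2 := by
      rw [Finset.sum_const, Finset.card_range, nsmul_eq_mul]
      field_simp
    _ < ε := half_lt_self hε

/-- The Poisson kernel has Fourier coefficients `q ^ r`. -/
theorem integral_poisson_mul_cos {q : ℝ} (hq : |q| < 1) (r : ℕ) :
    ∫ θ in (0 : ℝ)..2 * Real.pi,
        (1 - q ^ 2) / (1 - 2 * q * Real.cos θ + q ^ 2) * Real.cos (r * θ)
      = 2 * Real.pi * q ^ r := by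
  have hnorm (θ : ℝ) : ‖circleMap 0 1 θ - q‖ ^ 2 = 1 - 2 * q * Real.cos θ + q ^ 2 := by
    rw [← Complex.normSq_eq_norm_sq, Complex.normSq_apply]
    simp only [circleMap_zero, Complex.ofReal_one, one_mul, Complex.sub_re, Complex.sub_im,
      Complex.exp_ofReal_mul_I_re, Complex.exp_ofReal_mul_I_im, Complex.ofReal_re,
      Complex.ofReal_im]
    linear_combination Real.sin_sq_add_cos_sq θ
  have hpos (θ : ℝ) : 1 - 2 * q * Real.cos θ + q ^ 2 ≠ 0 := by
    rw [← hnorm, ne_eq, sq_eq_zero_iff, norm_eq_zero, sub_eq_zero]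
    intro h
    have h_norm := congrArg norm h
    rw [norm_circleMap_zero, abs_one, Complex.norm_real, Real.norm_eq_abs] at h_norm
    exact hq.ne' h_norm
  have hpow (θ : ℝ) : (circleMap 0 1 θ ^ r).re = Real.cos (r * θ) := by
    rw [circleMap_zero, Complex.ofReal_one, one_mul, ← Complex.exp_nat_mul, ← mul_assoc,
      ← Complex.ofReal_natCast, ← Complex.ofReal_mul, Complex.exp_ofReal_mul_I_re]
  have hd : DiffContOnCl ℂ (fun z : ℂ => z ^ r) (Metric.ball 0 1) :=
    (differentiable_pow r).diffContOnCl
  have hP := hd.circleAverage_poissonKernel_smul' (w := (q : ℂ)) (by simpa using hq)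
  simp only [Real.circleAverage_def, sub_zero, norm_circleMap_zero, hnorm, Complex.norm_real,
    Real.norm_eq_abs, sq_abs, one_pow, abs_one] at hP
  have hcont : Continuous fun θ : ℝ =>
      ((1 - q ^ 2) / (1 - 2 * q * Real.cos θ + q ^ 2)) • circleMap 0 1 θ ^ r := by
    refine Continuous.smul (Continuous.div (by fun_prop) (by fun_prop) hpos) ?_
    exact (continuous_circleMap 0 1).pow r
  have hre := congrArg Complex.re hP
  rw [Complex.smul_re, ← Complex.reCLM_apply, ← Complex.reCLM.intervalIntegral_comp_comm
    (hcont.intervalIntegrable _ _), ← Complex.ofReal_pow, Complex.ofReal_re] at hre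
  simp only [Complex.reCLM_apply, Complex.smul_re, hpow, smul_eq_mul] at hre
  rw [← hre, mul_inv_cancel_left₀ (by positivity)]

theorem add_mul_cos_pos {α β : ℝ} (hαβ : |β| < α) (θ : ℝ) : 0 < α + β * Real.cos θ := by
  have h : |β * Real.cos θ| ≤ |β| := by
    rw [abs_mul]
    exact mul_le_of_le_one_right (abs_nonneg β) (Real.abs_cos_le_one θ)
  linarith [neg_abs_le (β * Real.cos θ)]

theorem integral_cos_div_add_mul_cos {α β : ℝ} (hαβ : |β| < α) (r : ℕ) :
    ∫ x in (0 : ℝ)..1, Real.cos (2 * Real.pi * r * x) / (α + β * Real.cos (2 * Real.pi * x))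
      = (-β) ^ r / (Real.sqrt (α ^ 2 - β ^ 2) * (α + Real.sqrt (α ^ 2 - β ^ 2)) ^ r) := by
  have hα : 0 < α := (abs_nonneg β).trans_lt hαβ
  have hsq : 0 < α ^ 2 - β ^ 2 := sub_pos.mpr (sq_lt_sq.mpr (by rwa [abs_of_pos hα]))
  set s := Real.sqrt (α ^ 2 - β ^ 2)
  have hs : 0 < s := Real.sqrt_pos.mpr hsq
  have hs2 : s ^ 2 = α ^ 2 - β ^ 2 := Real.sq_sqrt hsq.le
  have hαs : 0 < α + s := add_pos hα hs
  have hq : |-β / (α + s)| < 1 := by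
    rw [abs_div, abs_neg, abs_of_pos hαs, div_lt_one hαs]
    linarith
  have hkernel (θ : ℝ) : Real.cos (r * θ) / (α + β * Real.cos θ)
      = s⁻¹ * ((1 - (-β / (α + s)) ^ 2) / (1 - 2 * (-β / (α + s)) * Real.cos θ
        + (-β / (α + s)) ^ 2) * Real.cos (r * θ)) := by
    have h := (add_mul_cos_pos hαβ θ).ne'
    have hnum : 1 - (-β / (α + s)) ^ 2 = 2 / (α + s) * s := by
      field_simp
      linear_combination -hs2
    have hden : 1 - 2 * (-β / (α + s)) * Real.cos θ + (-β / (α + s)) ^ 2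
        = 2 / (α + s) * (α + β * Real.cos θ) := by
      field_simp
      linear_combination hs2
    rw [hnum, hden]
    field_simp
  have hscale := intervalIntegral.integral_comp_mul_left (a := 0) (b := 1)
    (fun θ => Real.cos (r * θ) / (α + β * Real.cos θ)) Real.two_pi_pos.ne'
  simp only [mul_zero, mul_one] at hscale
  have hcomm (x : ℝ) : 2 * Real.pi * r * x = r * (2 * Real.pi * x) := by ring
  simp only [hcomm]
  rw [hscale]
  simp only [hkernel]
  rw [intervalIntegral.integral_const_mul, integral_poisson_mul_cos hq, smul_eq_mul, div_pow]
  field_simp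

/-- For `α > |β|` and `r ∈ ℕ`,
`∫₀¹ cos(2πrx)/(α + β cos(2πx)) dx = (−β)^r/(√(α²−β²)(α+√(α²−β²))^r)`; in particular the
Riemann sums `(1/n)·Σ_{l<n} cos(2πrl/n)/(α + β cos(2πl/n))` converge to this value as
`n → ∞`. -/
theorem stmt19 (α β : ℝ) (hαβ : |β| < α) (r : ℕ) :
    (∫ x in (0 : ℝ)..1, Real.cos (2 * Real.pi * r * x) / (α + β * Real.cos (2 * Real.pi * x))
        = (-β) ^ r /
          (Real.sqrt (α ^ 2 - β ^ 2) * (α + Real.sqrt (α ^ 2 - β ^ 2)) ^ r)) ∧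
    Tendsto
      (fun n : ℕ => (1 / (n : ℝ)) * ∑ l ∈ Finset.range n,
        Real.cos (2 * Real.pi * r * l / n) / (α + β * Real.cos (2 * Real.pi * l / n)))
      atTop
      (nhds ((-β) ^ r /
        (Real.sqrt (α ^ 2 - β ^ 2) * (α + Real.sqrt (α ^ 2 - β ^ 2)) ^ r))) := by
  refine ⟨integral_cos_div_add_mul_cos hαβ r, ?_⟩
  rw [← integral_cos_div_add_mul_cos hαβ r]
  have hcont : Continuous fun x : ℝ =>
      Real.cos (2 * Real.pi * r * x) / (α + β * Real.cos (2 * Real.pi * x)) :=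
    Continuous.div (by fun_prop) (by fun_prop) fun x => (add_mul_cos_pos hαβ _).ne'
  simpa only [mul_div_assoc] using tendsto_riemann_sum_integral hcont
end
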